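/- Let F be a field of characteristic 2, let j ≥ 1 be a natural number, and for each i ∈ {1, …, j} let V_i be a 4-dimensional F-vector space and x_i ∈ GL(V_i) an element with x_i² = 1 and rank(x_i − 1) = 1. Then the fixed-point subspace of the tensor product automorphism x_1 ⊗ x_2 ⊗ ⋯ ⊗ x_j of V_1 ⊗ V_2 ⊗ ⋯ ⊗ V_j has dimension (4^j + 2^j)/2 = 2^{2j−1} + 2^{j−1}. -/

import Mathlib

open Module
lemma permFix {F ι W : Type*} [Field F] [Fintype ι] [DecidableEq ι] [AddCommGroup W] [Module F W]
   (b : Basis ι F W) (σ : Equiv.Perm ι) (hσ : ∀ i, σ (σ i) = i) (f : W →ₗ[F] W)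
   (hf : ∀ i, f (b i) = b (σ i)) :
   2 * finrank F (LinearMap.ker (f - LinearMap.id)) = Fintype.card ι + Fintype.card {i // σ i = i} := by
  classical
  letI : LinearOrder ι := LinearOrder.lift' (Fintype.equivFin ι) (Fintype.equivFin ι).injective
  have hrep : ∀ v i, b.repr (f v) i = b.repr v (σ i) := by
    intro v i
    have : (Finsupp.lapply i ∘ₗ b.repr.toLinearMap ∘ₗ f) = (Finsupp.lapply (σ i) ∘ₗ b.repr.toLinearMap) := by
      apply b.ext
      intro k
      simp only [LinearMap.comp_apply, hf, LinearEquiv.coe_coe, Basis.repr_self, Finsupp.lapply_apply,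
        Finsupp.single_apply]
      have : σ k = i ↔ k = σ i := ⟨fun h => by rw [← h, hσ], fun h => by rw [h, hσ]⟩
      simp only [this]
    exact LinearMap.congr_fun this v
  have hker : ∀ v, v ∈ LinearMap.ker (f - LinearMap.id) ↔ ∀ i, b.repr v (σ i) = b.repr v i := by
    intro v
    rw [LinearMap.mem_ker, LinearMap.sub_apply, sub_eq_zero, LinearMap.id_apply, b.ext_elem_iff]
    simp only [hrep]
  let φ : LinearMap.ker (f - LinearMap.id) →ₗ[F] ({i // i ≤ σ i} → F) :=
    LinearMap.pi (fun i => Finsupp.lapply i.1 ∘ₗ b.repr.toLinearMap ∘ₗ (LinearMap.ker (f - LinearMap.id)).subtype)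
  have hφ : ∀ v i, φ v i = b.repr v.1 i.1 := fun v i => rfl
  have hbij : Function.Bijective φ := by
    constructor
    · rw [injective_iff_map_eq_zero]
      intro v hv
      have h1 : ∀ i, i ≤ σ i → b.repr v.1 i = 0 := fun i hi => by
        rw [← hφ v ⟨i, hi⟩, hv]; rfl
      apply Subtype.ext
      apply b.ext_elem
      intro i
      rw [ZeroMemClass.coe_zero, map_zero, Finsupp.zero_apply]
      rcases le_total i (σ i) with h | h
      · exact h1 i h
      · rw [← (hker v.1).1 v.2 i]
        exact h1 _ (by rw [hσ]; exact h)
    · intro g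
      let G : ι → F := fun i => if h : i ≤ σ i then g ⟨i, h⟩ else
        if h' : σ i ≤ σ (σ i) then g ⟨σ i, h'⟩ else 0
      have hG : ∀ i, G (σ i) = G i := by
        intro i
        simp only [G]
        rcases lt_trichotomy i (σ i) with h | h | h
        · have h2 : ¬ (σ i ≤ σ (σ i)) := by rw [hσ]; exact not_le.2 h
          rw [dif_neg h2, dif_pos h.le]
          simp only [hσ]
          rw [dif_pos h.le]
        · simp only [← h]
        · have h2 : (σ i ≤ σ (σ i)) := by rw [hσ]; exact h.le
          rw [dif_pos h2, dif_neg (not_le.2 h), dif_pos h2]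
      refine ⟨⟨b.equivFun.symm G, ?_⟩, ?_⟩
      · rw [hker]
        intro i
        have := fun k => congrFun (b.equivFun.apply_symm_apply G) k
        simp only [Basis.equivFun_apply] at this
        rw [this, this, hG]
      · ext i
        rw [hφ]
        have := congrFun (b.equivFun.apply_symm_apply G) i
        simp only [Basis.equivFun_apply] at this
        rw [this]
        simp only [G]
        rw [dif_pos i.2]
  rw [(LinearEquiv.ofBijective φ hbij).finrank_eq, finrank_fintype_fun_eq_card]
  rw [Fintype.card_subtype, Fintype.card_subtype]
  have e1 : (Finset.univ.filter (fun i => i ≤ σ i)).card = (Finset.univ.filter (fun i => σ i ≤ i)).card := by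
    refine Finset.card_bij' (fun i _ => σ i) (fun i _ => σ i) ?_ ?_ ?_ ?_ <;> simp [hσ]
  have e2 := Finset.card_union_add_card_inter (Finset.univ.filter (fun i => i ≤ σ i)) (Finset.univ.filter (fun i => σ i ≤ i))
  rw [← e1, ← Finset.filter_or, ← Finset.filter_and, ← two_mul] at e2
  rw [← e2]
  congr 1
  · rw [Finset.filter_true_of_mem (fun i _ => le_total _ _), Finset.card_univ]
  · congr 1; ext i; simp [le_antisymm_iff, and_comm]

lemma exBasis {F V : Type*} [Field F] (h2 : (2:F) = 0) [AddCommGroup V] [Module F V] [FiniteDimensional F V]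
   (hd : finrank F V = 4) (x : V ≃ₗ[F] V) (hx2 : x ^ 2 = 1)
   (hr : finrank F (LinearMap.range (x.toLinearMap - LinearMap.id)) = 1) :
   ∃ b : Basis (Fin 4) F V, ∀ i, x (b i) = b (Equiv.swap 0 1 i) := by
  have hxx : ∀ v, x (x v) = v := fun v => by
    have := LinearEquiv.congr_fun hx2 v
    simpa [pow_two] using this
  set N := x.toLinearMap - LinearMap.id with hN
  have hNa : ∀ v, N v = x v - v := fun v => rfl
  have hv2 : ∀ v : V, v + v = 0 := fun v => by rw [← two_smul F, h2, zero_smul]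
  have hNN : ∀ v, N (N v) = 0 := fun v => by
    rw [hNa, hNa, map_sub, hxx]
    have e : v - x v - (x v - v) = (v + v) - (x v + x v) := by abel
    rw [e, hv2, hv2, sub_zero]
  have hk : finrank F (LinearMap.ker N) = 3 := by
    have := N.finrank_range_add_finrank_ker
    omega
  obtain ⟨w, hw⟩ : ∃ w, N w ≠ 0 := by
    by_contra! h
    have : N = 0 := LinearMap.ext h
    rw [this, LinearMap.range_zero, finrank_bot] at hr
    omega
  let u : LinearMap.ker N := ⟨N w, hNN w⟩
  have hu : u ≠ 0 := fun h => hw (congrArg Subtype.val h)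
  obtain ⟨C, hC⟩ := Submodule.exists_isCompl (Submodule.span F {u})
  have hC2 : finrank F C = 2 := by
    have := Submodule.finrank_add_eq_of_isCompl hC
    rw [finrank_span_singleton hu] at this
    omega
  let c := Module.finBasisOfFinrankEq F C hC2
  have hNc : ∀ i, N ((c i).1.1) = 0 := fun i => (c i).1.2
  have hxc : ∀ i, x ((c i).1.1) = (c i).1.1 := fun i => by
    have := hNc i
    rwa [hNa, sub_eq_zero] at this
  have hNx : N (x w) = N w := by
    have : x w = N w + w := by rw [hNa]; abel
    rw [this, map_add, hNN, zero_add]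
  have hli : LinearIndependent F ![w, x w, (c 0).1.1, (c 1).1.1] := by
    rw [Fintype.linearIndependent_iff]
    intro g hg
    simp only [Fin.sum_univ_four, Matrix.cons_val] at hg
    have h3 := congrArg N hg
    simp only [map_add, map_smul, hNc, smul_zero, add_zero, hNx, map_zero, ← add_smul] at h3
    have h4 : g 0 + g 1 = 0 := (smul_eq_zero.1 h3).resolve_right hw
    have h5 : g 0 = - g 1 := eq_neg_of_add_eq_zero_left h4
    have h6 : g 1 • u + (g 2 • c 0 + g 3 • c 1 : C).1 = 0 := by
      apply Subtype.ext
      simp only [u, Submodule.coe_add, Submodule.coe_smul, Submodule.coe_zero, hNa]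
      rw [← hg, h5, smul_sub, neg_smul]
      abel
    have h7 : g 1 • u = 0 := by
      apply Submodule.disjoint_def.1 hC.disjoint
      · exact Submodule.smul_mem _ _ (Submodule.mem_span_singleton_self u)
      · rw [eq_neg_of_add_eq_zero_left h6]
        exact C.neg_mem (Subtype.property _)
    have h8 : g 1 = 0 := (smul_eq_zero.1 h7).resolve_right hu
    rw [h7, zero_add] at h6
    have h9 : g 2 • c 0 + g 3 • c 1 = 0 := Subtype.ext h6
    have h10 := Fintype.linearIndependent_iff.1 c.linearIndependent ![g 2, g 3] (by simpa using h9)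
    have h11 := h10 0
    have h12 := h10 1
    simp at h11 h12
    intro i
    fin_cases i
    · simpa [h8] using h5
    · exact h8
    · exact h11
    · exact h12
  refine ⟨basisOfLinearIndependentOfCardEqFinrank hli (by simp [hd]), ?_⟩
  rw [coe_basisOfLinearIndependentOfCardEqFinrank]
  intro i
  fin_cases i
  · simp
  · simp [hxx]
  · have : Equiv.swap (0 : Fin 4) 1 2 = 2 := by decide
    simp [this, hxc]
  · have : Equiv.swap (0 : Fin 4) 1 3 = 3 := by decide
    simp [this, hxc]

open scoped TensorProduct

/-- Let `F` be a field of characteristic 2, `j ≥ 1`, and for `i ∈ {1, …, j}` let `Vᵢ` be a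
4-dimensional `F`-space and `xᵢ ∈ GL(Vᵢ)` an involution with `rank(xᵢ − 1) = 1`. Then the
fixed-point space of `x₁ ⊗ ⋯ ⊗ x_j` on `V₁ ⊗ ⋯ ⊗ V_j` has dimension
`2^{2j−1} + 2^{j−1}`. -/
theorem stmt6 {F : Type*} [Field F] (hF : ringChar F = 2) {j : ℕ} (hj : 1 ≤ j)
    (V : Fin j → Type*) [∀ i, AddCommGroup (V i)] [∀ i, Module F (V i)]
    [∀ i, FiniteDimensional F (V i)] (hdim : ∀ i, Module.finrank F (V i) = 4)
    (x : ∀ i, V i ≃ₗ[F] V i) (hx2 : ∀ i, x i ^ 2 = 1)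
    (hxr : ∀ i, Module.finrank F
      (LinearMap.range ((x i).toLinearMap - LinearMap.id)) = 1) :
    Module.finrank F (LinearMap.ker
        (PiTensorProduct.map (fun i => (x i).toLinearMap) - LinearMap.id)) =
      2 ^ (2 * j - 1) + 2 ^ (j - 1) := by
  have h2 : (2 : F) = 0 := by
    have := ringChar.Nat.cast_ringChar (R := F)
    rw [hF] at this
    exact_mod_cast this
  choose b hb using fun i => exBasis h2 (hdim i) (x i) (hx2 i) (hxr i)
  let τ : Equiv.Perm (Fin 4) := Equiv.swap 0 1
  have hτ : ∀ i, τ (τ i) = i := fun i => Equiv.swap_apply_self _ _ _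
  have key := permFix (Basis.piTensorProduct b) (Equiv.piCongrRight fun _ => τ)
    (fun p => funext fun i => hτ (p i)) (PiTensorProduct.map (fun i => (x i).toLinearMap))
    (fun p => by
      rw [Basis.piTensorProduct_apply, Basis.piTensorProduct_apply, PiTensorProduct.map_tprod]
      congr 1
      funext i
      exact hb i (p i))
  have hc : Fintype.card {p : Fin j → Fin 4 // (Equiv.piCongrRight fun _ => τ) p = p} = 2 ^ j := by
    have e : {p : Fin j → Fin 4 // (Equiv.piCongrRight fun _ => τ) p = p} ≃
        (Fin j → {a : Fin 4 // τ a = a}) :=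
      (Equiv.subtypeEquivRight fun p => by rw [funext_iff]; rfl).trans
        (Equiv.subtypePiEquivPi (p := fun _ a => τ a = a))
    rw [Fintype.card_congr e, Fintype.card_fun, Fintype.card_fin]
    congr 1
  rw [hc, Fintype.card_fun, Fintype.card_fin, Fintype.card_fin] at key
  obtain ⟨k, rfl⟩ : ∃ k, j = k + 1 := ⟨j - 1, by omega⟩
  have e1 : (4 : ℕ) ^ (k + 1) = 2 * 2 ^ (2 * (k + 1) - 1) := by
    rw [← pow_succ', show 2 * (k + 1) - 1 + 1 = 2 * (k + 1) by omega, pow_mul]; norm_num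
  have e2 : (2 : ℕ) ^ (k + 1) = 2 * 2 ^ (k + 1 - 1) := by
    rw [← pow_succ']; rfl
  rw [e1, e2] at key
  omega
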